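/- Let ‖·‖ be a strictly convex norm on ℝ² with closed unit ball Ω and dual unit ball Ω° (the polar of Ω), and let Q be an area parametrization of ∂Ω°. Fix φ ∈ ℝ, ω ≠ 0 and r > 0, and define the curve x(t) := (r/ω)(Q₂(φ+ωt) − Q₂(φ)), y(t) := −(r/ω)(Q₁(φ+ωt) − Q₁(φ)), z(t) := (r²/(2ω²))(ωt + Q₁(φ+ωt)·Q₂(φ) − Q₂(φ+ωt)·Q₁(φ)). Then for almost every t ∈ ℝ: z′(t) = (x(t)·y′(t) − y(t)·x′(t))/2 and ‖(x′(t), y′(t))‖ = r. That is, the geodesics of the sub-Finsler Heisenberg group given by these formulas are horizontal curves of constant speed r, and z(t) equals the signed area swept by the vector joining (0,0) with (x(s),y(s)) for s ∈ [0,t]. -/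

import Mathlib

open MeasureTheory

/-- A (symmetric) norm on `ℝ × ℝ`. -/
structure IsNorm2 (nrm : ℝ × ℝ → ℝ) : Prop where
  eq_zero_iff : ∀ x, nrm x = 0 ↔ x = 0
  smul_eq : ∀ (a : ℝ) (x : ℝ × ℝ), nrm (a • x) = |a| * nrm x
  triangle : ∀ x y, nrm (x + y) ≤ nrm x + nrm y

/-- `nrm` is `C^{1,1}` on `ℝ² ∖ {0}`: differentiable there, with locally Lipschitz derivative. -/
def IsC11Away (nrm : ℝ × ℝ → ℝ) : Prop :=
  DifferentiableOn ℝ nrm {x | x ≠ 0} ∧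
    ∀ x : ℝ × ℝ, x ≠ 0 → ∃ ε > (0:ℝ), ∃ K : NNReal,
      LipschitzOnWith K (fderiv ℝ nrm) (Metric.ball x ε \ {0})

/-- The Euclidean pairing on `ℝ × ℝ`. -/
def dot2 (p q : ℝ × ℝ) : ℝ := p.1 * q.1 + p.2 * q.2

/-- The polar set of a subset of `ℝ²`. -/
def polar2 (K : Set (ℝ × ℝ)) : Set (ℝ × ℝ) := {q | ∀ x ∈ K, dot2 q x ≤ 1}

/-- The closed unit ball of the norm `nrm`. -/
def unitBall2 (nrm : ℝ × ℝ → ℝ) : Set (ℝ × ℝ) := {x | nrm x ≤ 1}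

/-- An area parametrization of the boundary of `K`: a locally Lipschitz curve tracing
`frontier K` which sweeps area at unit rate, i.e. `R₁ R₂′ − R₂ R₁′ = 1` a.e.
(equivalently `R θ = (cos_K θ, sin_K θ)` in the paper's convex trigonometry). -/
structure IsAreaParam (K : Set (ℝ × ℝ)) (R : ℝ → ℝ × ℝ) : Prop where
  lipschitz : LocallyLipschitz R
  mem_frontier : ∀ θ, R θ ∈ frontier K
  area : ∀ᵐ θ : ℝ ∂volume, ∃ v : ℝ × ℝ, HasDerivAt R v θ ∧ (R θ).1 * v.2 - (R θ).2 * v.1 = 1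

/-- Horizontal component `x` of the Heisenberg geodesic with data `(φ,ω,r)`. -/
noncomputable def xG (Q : ℝ → ℝ × ℝ) (φ ω r t : ℝ) : ℝ :=
  (r / ω) * ((Q (φ + ω * t)).2 - (Q φ).2)

/-- Horizontal component `y` of the Heisenberg geodesic with data `(φ,ω,r)`. -/
noncomputable def yG (Q : ℝ → ℝ × ℝ) (φ ω r t : ℝ) : ℝ :=
  -(r / ω) * ((Q (φ + ω * t)).1 - (Q φ).1)

/-- Vertical component `z` of the Heisenberg geodesic with data `(φ,ω,r)`. -/
noncomputable def zG (Q : ℝ → ℝ × ℝ) (φ ω r t : ℝ) : ℝ :=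
  (r ^ 2 / (2 * ω ^ 2)) *
    (ω * t + (Q (φ + ω * t)).1 * (Q φ).2 - (Q (φ + ω * t)).2 * (Q φ).1)

theorem IsNorm2.nonneg {nrm : ℝ × ℝ → ℝ} (h : IsNorm2 nrm) (x : ℝ × ℝ) : 0 ≤ nrm x := by
  have h0 : nrm 0 = 0 := (h.eq_zero_iff 0).2 rfl
  have hneg : nrm ((-1 : ℝ) • x) = nrm x := by rw [h.smul_eq]; simp
  have ht := h.triangle x ((-1 : ℝ) • x)
  have hx : x + (-1 : ℝ) • x = 0 := by simp
  rw [hx, h0, hneg] at ht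
  linarith

theorem IsNorm2.continuous {nrm : ℝ × ℝ → ℝ} (h : IsNorm2 nrm) : Continuous nrm := by
  have hconv : ConvexOn ℝ Set.univ nrm := by
    refine ⟨convex_univ, fun x _ y _ a b ha hb _ => ?_⟩
    have ht := h.triangle (a • x) (b • y)
    rwa [h.smul_eq, h.smul_eq, abs_of_nonneg ha, abs_of_nonneg hb] at ht
  exact continuousOn_univ.1 (hconv.continuousOn isOpen_univ)

theorem IsNorm2.isCompact_unitBall2 {nrm : ℝ × ℝ → ℝ} (h : IsNorm2 nrm) :
    IsCompact (unitBall2 nrm) := by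
  have hclosed : IsClosed (unitBall2 nrm) := isClosed_le h.continuous continuous_const
  obtain ⟨u, hu, hmin⟩ := (isCompact_sphere (0 : ℝ × ℝ) 1).exists_isMinOn
    (NormedSpace.sphere_nonempty.2 zero_le_one) h.continuous.continuousOn
  have hu0 : u ≠ 0 := ne_zero_of_mem_unit_sphere ⟨u, hu⟩
  have hpos : 0 < nrm u :=
    lt_of_le_of_ne (h.nonneg u) fun h0 => hu0 ((h.eq_zero_iff u).1 h0.symm)
  refine (isCompact_closedBall (0 : ℝ × ℝ) (nrm u)⁻¹).of_isClosed_subset hclosed fun x hx => ?_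
  rw [mem_closedBall_zero_iff]
  rcases eq_or_ne x 0 with rfl | hx0
  · simpa using hpos.le
  have hxn : 0 < ‖x‖ := norm_pos_iff.2 hx0
  have hmem : ‖x‖⁻¹ • x ∈ Metric.sphere (0 : ℝ × ℝ) 1 := by
    rw [mem_sphere_zero_iff_norm, norm_smul, norm_inv, norm_norm, inv_mul_cancel₀ hxn.ne']
  have hle : nrm u ≤ nrm (‖x‖⁻¹ • x) := hmin hmem
  rw [h.smul_eq, abs_of_pos (inv_pos.2 hxn), inv_mul_eq_div, le_div_iff₀ hxn] at hle
  rw [← one_div, le_div_iff₀ hpos, mul_comm]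
  exact hle.trans hx

theorem isClosed_polar2 (K : Set (ℝ × ℝ)) : IsClosed (polar2 K) := by
  simp only [polar2, Set.ofPred_forall]
  refine isClosed_biInter fun x _ => isClosed_le ?_ continuous_const
  unfold dot2
  fun_prop

/-- A boundary point of the polar of a compact set is supported by a point of that set. -/
theorem exists_dot2_eq_one_of_mem_frontier_polar2 {K : Set (ℝ × ℝ)} (hK : IsCompact K)
    {q : ℝ × ℝ} (hq : q ∈ frontier (polar2 K)) : ∃ x ∈ K, dot2 q x = 1 := by
  have hmem : q ∈ polar2 K := (isClosed_polar2 K).frontier_subset hq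
  by_contra! hne
  refine hq.2 (mem_interior_iff_mem_nhds.2 ?_)
  have hcont : Continuous fun z : (ℝ × ℝ) × (ℝ × ℝ) => dot2 z.1 z.2 := by
    unfold dot2
    fun_prop
  have hev : ∀ᶠ q' in nhds q, ∀ x ∈ K, dot2 q' x < 1 :=
    hK.eventually_forall_of_forall_eventually fun x hx =>
      hcont.continuousAt.eventually_lt continuousAt_const (lt_of_le_of_ne (hmem x hx) (hne x hx))
  filter_upwards [hev] with q' hq' x hx using (hq' x hx).le

/-- The velocity of an area parametrization of the dual unit circle, rotated by a right angle,
is a unit vector. -/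
theorem IsAreaParam.nrm_rotated_deriv {nrm : ℝ × ℝ → ℝ} (h : IsNorm2 nrm) {Q : ℝ → ℝ × ℝ}
    (hQ : IsAreaParam (polar2 (unitBall2 nrm)) Q) {θ : ℝ} {v : ℝ × ℝ} (hv : HasDerivAt Q v θ)
    (harea : (Q θ).1 * v.2 - (Q θ).2 * v.1 = 1) : nrm (v.2, -v.1) = 1 := by
  have hmem (s : ℝ) : Q s ∈ polar2 (unitBall2 nrm) :=
    (isClosed_polar2 _).frontier_subset (hQ.mem_frontier s)
  obtain ⟨x, hx, hdot⟩ :=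
    exists_dot2_eq_one_of_mem_frontier_polar2 h.isCompact_unitBall2 (hQ.mem_frontier θ)
  have hmax : IsLocalMax (fun s => dot2 (Q s) x) θ :=
    Filter.Eventually.of_forall fun s => (hmem s x hx).trans hdot.ge
  have hfst : HasDerivAt (fun s => (Q s).1) v.1 θ := hv.fst
  have hsnd : HasDerivAt (fun s => (Q s).2) v.2 θ := hv.snd
  have hder : HasDerivAt (fun s => dot2 (Q s) x) (v.1 * x.1 + v.2 * x.2) θ :=
    (hfst.mul_const x.1).add (hsnd.mul_const x.2)
  have hzero : v.1 * x.1 + v.2 * x.2 = 0 := hmax.hasDerivAt_eq_zero hder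
  unfold dot2 at hdot
  have hxv : (v.2, -v.1) = x := by
    ext
    · linear_combination x.1 * harea - v.2 * hdot + (Q θ).2 * hzero
    · linear_combination x.2 * harea + v.1 * hdot - (Q θ).1 * hzero
  rw [hxv]
  refine le_antisymm hx ?_
  have hpos : 0 < nrm x := by
    refine lt_of_le_of_ne (h.nonneg x) fun h0 => ?_
    rw [(h.eq_zero_iff x).1 h0.symm] at hdot
    simp at hdot
  have hunit : (nrm x)⁻¹ • x ∈ unitBall2 nrm := by
    show nrm _ ≤ 1
    rw [h.smul_eq, abs_of_pos (inv_pos.2 hpos), inv_mul_cancel₀ hpos.ne']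
  have hle := hmem θ _ hunit
  have heq : dot2 (Q θ) ((nrm x)⁻¹ • x) = (nrm x)⁻¹ := by
    simp only [dot2, Prod.smul_fst, Prod.smul_snd, smul_eq_mul]
    linear_combination (nrm x)⁻¹ * hdot
  rw [heq] at hle
  exact (inv_le_one₀ hpos).1 hle

theorem quasiMeasurePreserving_const_add_mul (φ : ℝ) {ω : ℝ} (hω : ω ≠ 0) :
    Measure.QuasiMeasurePreserving (fun t : ℝ => φ + ω * t) volume volume := by
  refine (measurePreserving_add_left volume φ).quasiMeasurePreserving.comp
    ⟨measurable_const_mul ω, ?_⟩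
  rw [Real.map_volume_mul_left hω]
  exact Measure.smul_absolutelyContinuous

/-- The curves `(x,y,z)` given by convex trigonometry are horizontal curves of the
Heisenberg group of constant speed `r`: a.e. `z′ = (x y′ − y x′)/2` and
`‖(x′,y′)‖ = r`. -/
theorem heisenberg_geodesics_horizontal_constant_speed
    (nrm : ℝ × ℝ → ℝ) (h1 : IsNorm2 nrm)
    (h2 : StrictConvexOn ℝ Set.univ fun x => (nrm x) ^ 2)
    (Q : ℝ → ℝ × ℝ) (hQ : IsAreaParam (polar2 (unitBall2 nrm)) Q)
    (φ ω r : ℝ) (hω : ω ≠ 0) (hr : 0 < r) :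
    ∀ᵐ t : ℝ ∂volume, ∃ vx vy vz : ℝ,
      HasDerivAt (xG Q φ ω r) vx t ∧ HasDerivAt (yG Q φ ω r) vy t ∧
      HasDerivAt (zG Q φ ω r) vz t ∧
      vz = (xG Q φ ω r t * vy - yG Q φ ω r t * vx) / 2 ∧
      nrm (vx, vy) = r := by
  filter_upwards [(quasiMeasurePreserving_const_add_mul φ hω).ae hQ.area] with t ⟨v, hv, harea⟩
  have hlin : HasDerivAt (fun t : ℝ => φ + ω * t) ω t := by
    simpa using ((hasDerivAt_id t).const_mul ω).const_add φ
  have hcomp : HasDerivAt (fun t => Q (φ + ω * t)) (ω • v) t := hv.scomp t hlin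
  have hfst : HasDerivAt (fun t => (Q (φ + ω * t)).1) (ω * v.1) t := hcomp.fst
  have hsnd : HasDerivAt (fun t => (Q (φ + ω * t)).2) (ω * v.2) t := hcomp.snd
  have hx := (hsnd.sub_const (Q φ).2).const_mul (r / ω)
  have hy := (hfst.sub_const (Q φ).1).const_mul (-(r / ω))
  have hz := ((((hasDerivAt_id t).const_mul ω).add (hfst.mul_const (Q φ).2)).sub
    (hsnd.mul_const (Q φ).1)).const_mul (r ^ 2 / (2 * ω ^ 2))
  refine ⟨_, _, _, hx, hy, hz, ?_, ?_⟩
  · simp only [xG, yG]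
    field_simp
    linear_combination -harea
  · have hvel : (r / ω * (ω * v.2), -(r / ω) * (ω * v.1)) = r • (v.2, -v.1) := by
      ext <;> simp <;> field_simp
    rw [hvel, h1.smul_eq, hQ.nrm_rotated_deriv h1 hv harea, abs_of_pos hr, mul_one]
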